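/- (Closed form of the truncated Gaussian second-moment kernel Ψ appearing in Theorem 2.) Let a > 0 and b ∈ ℝ. Then Ψ(a,b) := ∫_{-∞}^0 w² · (1/(a√(2π))) e^{-w²/(2a²)} · Φ(b w) dw = a²/4 − (a²/(2π))·( arctan(a b) + a b/(1 + a² b²) ). In particular Ψ(a,0) = a²/4, Ψ(a,b) → 0 as b → +∞, and Ψ(a,b) → a²/2 as b → −∞. -/

import Mathlib

open MeasureTheory Real Filter Set

noncomputable def Phi (x : ℝ) : ℝ :=
  ∫ t in Set.Iic x, (Real.sqrt (2 * Real.pi))⁻¹ * Real.exp (-t ^ 2 / 2)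

noncomputable def Q (x : ℝ) : ℝ := 1 - Phi x

noncomputable def gaussPDF (σ n : ℝ) : ℝ :=
  (σ * Real.sqrt (2 * Real.pi))⁻¹ * Real.exp (-n ^ 2 / (2 * σ ^ 2))

noncomputable def E1 (x : ℝ) : ℝ := ∫ t in Set.Ioi x, Real.exp (-t) / t


noncomputable def Psi (a b : ℝ) : ℝ :=
  ∫ w in Set.Iic (0:ℝ),
    w ^ 2 * ((a * Real.sqrt (2 * Real.pi))⁻¹ * Real.exp (-w ^ 2 / (2 * a ^ 2))) * Phi (b * w)


lemma aux_gint : Integrable (fun t : ℝ => (Real.sqrt (2 * Real.pi))⁻¹ * Real.exp (-t ^ 2 / 2)) := by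
  have h := (integrable_exp_neg_mul_sq (b := 1/2) (by norm_num)).const_mul (Real.sqrt (2 * Real.pi))⁻¹
  refine h.congr (Eventually.of_forall fun t => ?_)
  simp only
  congr 2
  ring

lemma aux_Phi_deriv (x : ℝ) :
    HasDerivAt Phi ((Real.sqrt (2 * Real.pi))⁻¹ * Real.exp (-x ^ 2 / 2)) x := by
  have hc : Continuous (fun t : ℝ => (Real.sqrt (2 * Real.pi))⁻¹ * Real.exp (-t ^ 2 / 2)) := by
    fun_prop
  have h1 : Phi = fun y => Phi 0 + ∫ t in (0:ℝ)..y,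
      (Real.sqrt (2 * Real.pi))⁻¹ * Real.exp (-t ^ 2 / 2) := by
    funext y
    rw [← intervalIntegral.integral_Iic_sub_Iic aux_gint.integrableOn aux_gint.integrableOn]
    simp only [Phi]
    ring
  rw [h1]
  exact (hc.integral_hasStrictDerivAt 0 x).hasDerivAt.const_add _

lemma aux_Phi_zero : Phi 0 = 1 / 2 := by
  have h := integral_comp_neg_Ioi (0:ℝ)
    (fun t : ℝ => (Real.sqrt (2 * Real.pi))⁻¹ * Real.exp (-t ^ 2 / 2))
  rw [neg_zero] at h
  unfold Phi
  rw [← h, integral_const_mul]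
  have h2 := integral_gaussian_Ioi (1/2)
  have h3 : ∀ x : ℝ, -(-x) ^ 2 / 2 = -(1/2) * x ^ 2 := fun x => by ring
  simp only [h3]
  rw [h2]
  have h4 : π / (1/2) = 2 * π := by ring
  rw [h4]
  have : Real.sqrt (2 * π) ≠ 0 := by positivity
  field_simp

lemma aux_Phi_nonneg (x : ℝ) : 0 ≤ Phi x := by
  unfold Phi
  exact integral_nonneg fun t => by positivity

lemma aux_Phi_le (x : ℝ) : Phi x ≤ ∫ t : ℝ, (Real.sqrt (2 * Real.pi))⁻¹ * Real.exp (-t ^ 2 / 2) := by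
  unfold Phi
  exact setIntegral_le_integral aux_gint (Eventually.of_forall fun t => by positivity)

lemma aux_Psi (a b : ℝ) : Psi a b = ∫ w in Ioi (0:ℝ),
    w ^ 2 * ((a * Real.sqrt (2 * Real.pi))⁻¹ * Real.exp (-w ^ 2 / (2 * a ^ 2))) * Phi (-(b * w)) := by
  have h := integral_comp_neg_Ioi (0:ℝ) (fun w : ℝ => 
    w ^ 2 * ((a * Real.sqrt (2 * Real.pi))⁻¹ * Real.exp (-w ^ 2 / (2 * a ^ 2))) * Phi (b * w))
  rw [neg_zero] at h
  unfold Psi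
  rw [← h]
  simp only [neg_sq, mul_neg]

lemma aux_int (n : ℕ) {c : ℝ} (hc : 0 < c) :
    IntegrableOn (fun w : ℝ => w ^ n * Real.exp (-c * w ^ 2)) (Ioi 0) := by
  have h := integrableOn_rpow_mul_exp_neg_mul_sq hc (s := n)
    (by have : (0:ℝ) ≤ n := n.cast_nonneg
        linarith)
  simpa only [rpow_natCast] using h

lemma aux_val3 {c : ℝ} (hc : 0 < c) :
    ∫ w in Ioi (0:ℝ), w ^ 3 * Real.exp (-c * w ^ 2) = 1 / (2 * c ^ 2) := by
  have h := integral_rpow_mul_exp_neg_mul_rpow (p := 2) (q := 3) (b := c) (by norm_num) (by norm_num) hc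
  have h2 : ((3:ℝ) + 1) / 2 = 2 := by norm_num
  have h3 : -((3:ℝ) + 1) / 2 = -2 := by norm_num
  rw [h2, Real.Gamma_two] at h
  have e : ∀ w : ℝ, w ^ 3 * Real.exp (-c * w ^ 2) = w ^ (3:ℝ) * Real.exp (-c * w ^ (2:ℝ)) := by
    intro w
    norm_cast
  simp only [e]
  rw [h]
  simp only [h3, rpow_neg hc.le]
  norm_cast
  field_simp

lemma aux_val2 {c : ℝ} (hc : 0 < c) :
    ∫ w in Ioi (0:ℝ), w ^ 2 * Real.exp (-c * w ^ 2) = √π / (4 * c * √c) := by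
  have h := integral_rpow_mul_exp_neg_mul_rpow (p := 2) (q := 2) (b := c) (by norm_num) (by norm_num) hc
  have h2 : ((2:ℝ) + 1) / 2 = 1/2 + 1 := by norm_num
  have h3 : -((2:ℝ) + 1) / 2 = -(1 + 1/2) := by norm_num
  rw [h2, Real.Gamma_add_one (by norm_num), Real.Gamma_one_half_eq] at h
  have e : ∀ w : ℝ, w ^ 2 * Real.exp (-c * w ^ 2) = w ^ (2:ℝ) * Real.exp (-c * w ^ (2:ℝ)) := by
    intro w
    norm_cast
  simp only [e]
  rw [h]
  simp only [h3, rpow_neg hc.le]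
  rw [rpow_add hc, rpow_one, ← sqrt_eq_rpow]
  have : √c ≠ 0 := by positivity
  field_simp
  norm_num

lemma aux_Psi_zero {a : ℝ} (ha : 0 < a) : Psi a 0 = a ^ 2 / 4 := by
  rw [aux_Psi]
  simp only [zero_mul, neg_zero, aux_Phi_zero]
  have e : ∀ w : ℝ, w ^ 2 * ((a * Real.sqrt (2 * Real.pi))⁻¹ * Real.exp (-w ^ 2 / (2 * a ^ 2))) * (1/2)
      = ((a * Real.sqrt (2 * Real.pi))⁻¹ * (1/2)) * (w ^ 2 * Real.exp (-(1 / (2 * a ^ 2)) * w ^ 2)) := by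
    intro w
    rw [show -w ^ 2 / (2 * a ^ 2) = -(1 / (2 * a ^ 2)) * w ^ 2 by ring]
    ring
  simp only [e]
  rw [integral_const_mul, aux_val2 (by positivity)]
  have h1 : √(1 / (2 * a ^ 2)) = 1 / (√2 * a) := by
    rw [sqrt_div (by norm_num), sqrt_mul (by norm_num), sqrt_sq ha.le, sqrt_one]
  rw [h1, sqrt_mul (by norm_num)]
  have : √π ≠ 0 := by positivity
  have : √(2:ℝ) ≠ 0 := by positivity
  field_simp
  try norm_num

lemma aux_Psi_deriv {a : ℝ} (ha : 0 < a) (b : ℝ) :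
    HasDerivAt (fun b => Psi a b) (-(a ^ 3 / (π * (1 + a ^ 2 * b ^ 2) ^ 2))) b := by
  have hPc : Continuous Phi :=
    continuous_iff_continuousAt.2 fun x => (aux_Phi_deriv x).continuousAt
  have hexp : ∀ w : ℝ, -w ^ 2 / (2 * a ^ 2) = -(1 / (2 * a ^ 2)) * w ^ 2 := fun w => by ring
  have hca : 0 < 1 / (2 * a ^ 2) := by positivity
  have hcc : 0 < 1 / (2 * a ^ 2) + b ^ 2 / 2 := by positivity
  set K : ℝ := ∫ t : ℝ, (Real.sqrt (2 * Real.pi))⁻¹ * Real.exp (-t ^ 2 / 2) with hK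
  have key := hasDerivAt_integral_of_dominated_loc_of_deriv_le
    (μ := volume.restrict (Ioi (0:ℝ))) (x₀ := b) (s := univ)
    (F := fun b w => w ^ 2 * ((a * Real.sqrt (2 * Real.pi))⁻¹ * Real.exp (-w ^ 2 / (2 * a ^ 2)))
      * Phi (-(b * w)))
    (F' := fun b w => w ^ 2 * ((a * Real.sqrt (2 * Real.pi))⁻¹ * Real.exp (-w ^ 2 / (2 * a ^ 2)))
      * (((Real.sqrt (2 * Real.pi))⁻¹ * Real.exp (-(-(b * w)) ^ 2 / 2)) * (-w)))
    (bound := fun w => ((a * Real.sqrt (2 * Real.pi))⁻¹ * (Real.sqrt (2 * Real.pi))⁻¹) *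
      (w ^ 3 * Real.exp (-(1 / (2 * a ^ 2)) * w ^ 2)))
    univ_mem
    (Eventually.of_forall fun x => by
      apply Continuous.aestronglyMeasurable
      fun_prop)
    (by
      have h1 := (aux_int 2 hca).const_mul ((a * Real.sqrt (2 * Real.pi))⁻¹ * K)
      refine Integrable.mono' h1 ?_ ?_
      · apply Continuous.aestronglyMeasurable
        fun_prop
      · refine Eventually.of_forall fun w => ?_
        rw [hexp, norm_of_nonneg (mul_nonneg (by positivity) (aux_Phi_nonneg _))]
        calc _ ≤ w ^ 2 * ((a * √(2 * π))⁻¹ * rexp (-(1 / (2 * a ^ 2)) * w ^ 2)) * K :=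
              mul_le_mul_of_nonneg_left (aux_Phi_le _) (by positivity)
          _ = _ := by ring)
    (by
      apply Continuous.aestronglyMeasurable
      fun_prop)
    (by
      refine (ae_restrict_iff' measurableSet_Ioi).2 (Eventually.of_forall fun w hw x _ => ?_)
      have hw' : 0 < w := hw
      rw [hexp, mul_neg, mul_neg, norm_neg, norm_of_nonneg (by positivity)]
      have h1 : rexp (-(-(x * w)) ^ 2 / 2) ≤ 1 := by
        apply Real.exp_le_one_iff.2
        nlinarith [sq_nonneg (-(x * w))]
      calc _ ≤ w ^ 2 * ((a * √(2 * π))⁻¹ * rexp (-(1 / (2 * a ^ 2)) * w ^ 2)) *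
            ((√(2 * π))⁻¹ * 1 * w) := by gcongr
        _ = _ := by ring)
    ((aux_int 3 hca).const_mul _)
    (by
      refine Eventually.of_forall fun w x _ => ?_
      have h1 : HasDerivAt (fun x : ℝ => -(x * w)) (-w) x := by
        simpa using (((hasDerivAt_id' x).mul_const w).fun_neg)
      exact ((aux_Phi_deriv (-(x * w))).comp x h1).const_mul _)
  have h2 := key.2
  rw [show (fun b => Psi a b) = _ from funext fun b => aux_Psi a b]
  refine h2.congr_deriv ?_
  symm
  have e : ∀ w : ℝ, w ^ 2 * ((a * Real.sqrt (2 * Real.pi))⁻¹ * Real.exp (-w ^ 2 / (2 * a ^ 2)))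
      * (((Real.sqrt (2 * Real.pi))⁻¹ * Real.exp (-(-(b * w)) ^ 2 / 2)) * (-w))
      = (-((a * Real.sqrt (2 * Real.pi))⁻¹ * (Real.sqrt (2 * Real.pi))⁻¹)) *
      (w ^ 3 * Real.exp (-(1 / (2 * a ^ 2) + b ^ 2 / 2) * w ^ 2)) := by
    intro w
    rw [show -(1 / (2 * a ^ 2) + b ^ 2 / 2) * w ^ 2 =
      -w ^ 2 / (2 * a ^ 2) + -(-(b * w)) ^ 2 / 2 by ring, Real.exp_add]
    ring
  simp only [e]
  rw [integral_const_mul, aux_val3 hcc]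
  have h3 : (a * √(2 * π))⁻¹ * (√(2 * π))⁻¹ = 1 / (a * (2 * π)) := by
    rw [← mul_inv, mul_assoc, Real.mul_self_sqrt (by positivity), one_div]
  rw [h3]
  have h4 : 1 / (2 * a ^ 2) + b ^ 2 / 2 = (1 + a ^ 2 * b ^ 2) / (2 * a ^ 2) := by
    field_simp
  rw [h4]
  have : 1 + a ^ 2 * b ^ 2 ≠ 0 := by positivity
  field_simp
  try norm_num

lemma aux_rhs_deriv (a : ℝ) (b : ℝ) :
    HasDerivAt (fun b => a ^ 2 / 4 - a ^ 2 / (2 * Real.pi) *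
            (Real.arctan (a * b) + a * b / (1 + a ^ 2 * b ^ 2)))
      (-(a ^ 3 / (π * (1 + a ^ 2 * b ^ 2) ^ 2))) b := by
  have hp : 1 + a ^ 2 * b ^ 2 ≠ 0 := by positivity
  have h1 : HasDerivAt (fun b : ℝ => a * b) a b := by
    simpa using (hasDerivAt_id b).const_mul a
  have h2 : HasDerivAt (fun b : ℝ => 1 + a ^ 2 * b ^ 2) (a ^ 2 * (2 * b)) b := by
    simpa using ((hasDerivAt_pow 2 b).const_mul (a ^ 2)).const_add 1
  have h := ((h1.arctan.add (h1.div h2 hp)).const_mul (a ^ 2 / (2 * π))).const_sub (a ^ 2 / 4)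
  refine h.congr_deriv ?_
  rw [mul_pow]
  field_simp
  ring

lemma aux_closed (a : ℝ) (ha : 0 < a) (b : ℝ) : Psi a b
        = a ^ 2 / 4 - a ^ 2 / (2 * Real.pi) *
            (Real.arctan (a * b) + a * b / (1 + a ^ 2 * b ^ 2)) := by
  have hd := fun x => (aux_Psi_deriv ha x).sub (aux_rhs_deriv a x)
  have h := is_const_of_deriv_eq_zero (fun x => (hd x).differentiableAt)
    (fun x => by rw [(hd x).deriv]; ring) b 0
  simp [aux_Psi_zero ha] at h
  linarith

lemma aux_lim {l : Filter ℝ} (h : Tendsto (fun x : ℝ => x⁻¹) l (nhds 0)) (h0 : ∀ᶠ x in l, x ≠ 0) :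
    Tendsto (fun x : ℝ => x / (1 + x ^ 2)) l (nhds 0) := by
  have h1 : Tendsto (fun x : ℝ => x⁻¹ / (x⁻¹ ^ 2 + 1)) l (nhds (0 / (0 ^ 2 + 1))) :=
    h.div ((h.pow 2).add_const 1) (by norm_num)
  rw [zero_div] at h1
  refine h1.congr' ?_
  filter_upwards [h0] with x hx
  field_simp

theorem psi_closed_form (a : ℝ) (ha : 0 < a) :
    (∀ b : ℝ, Psi a b
        = a ^ 2 / 4 - a ^ 2 / (2 * Real.pi) *
            (Real.arctan (a * b) + a * b / (1 + a ^ 2 * b ^ 2))) ∧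
    Psi a 0 = a ^ 2 / 4 ∧
    Filter.Tendsto (fun b => Psi a b) Filter.atTop (nhds 0) ∧
    Filter.Tendsto (fun b => Psi a b) Filter.atBot (nhds (a ^ 2 / 2)) := by
  refine ⟨aux_closed a ha, aux_Psi_zero ha, ?_, ?_⟩
  · simp only [aux_closed a ha, ← mul_pow]
    have hb : Tendsto (fun b : ℝ => a * b) atTop atTop := tendsto_id.const_mul_atTop ha
    have h1 := (tendsto_arctan_atTop.mono_right nhdsWithin_le_nhds).comp hb
    have h2 := (aux_lim tendsto_inv_atTop_zero (eventually_ne_atTop 0)).comp hb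
    have h3 := ((h1.add h2).const_mul (a ^ 2 / (2 * π))).const_sub (a ^ 2 / 4)
    have h5 : (0:ℝ) = a ^ 2 / 4 - a ^ 2 / (2 * π) * (π / 2 + 0) := by
      field_simp
      ring
    rw [h5]
    exact h3
  · simp only [aux_closed a ha, ← mul_pow]
    have hb : Tendsto (fun b : ℝ => a * b) atBot atBot := tendsto_id.const_mul_atBot ha
    have h1 := (tendsto_arctan_atBot.mono_right nhdsWithin_le_nhds).comp hb
    have h2 := (aux_lim tendsto_inv_atBot_zero (eventually_ne_atBot 0)).comp hb
    have h3 := ((h1.add h2).const_mul (a ^ 2 / (2 * π))).const_sub (a ^ 2 / 4)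
    have h5 : a ^ 2 / 2 = a ^ 2 / 4 - a ^ 2 / (2 * π) * (-(π / 2) + 0) := by
      field_simp
      ring
    rw [h5]
    exact h3
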